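/- Extensivity of the Rényi 2-entropy for disconnected subsystems: fix integers d ≥ 2, D ≥ 2 and k ≥ 2 such that β := η(d,D)^{k−1} + η(D,d) + η(d,D) < 1. Then there exist constants c₁, c₂ > 0, depending only on d, D and k, such that for every n divisible by k, taking A := {k, 2k, …, n} to be the set consisting of every k-th site, one has Pr_{ψ ∼ μ_{d,n,D}} ( ψ ≠ 0 and S₂(ρ'_A) ≥ c₁ n/k ) ≥ 1 − e^{−c₂ n/k}. -/

import Mathlib

open MeasureTheory Matrix
open scoped ComplexConjugate

noncomputable section

instance matrixMeasurableSpace {m n : Type*} : MeasurableSpace (Matrix m n ℂ) :=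
  MeasurableSpace.pi

/-- The site tensor `A^{(m)}_i = (⟨i| ⊗ 1_D) U (|0⟩ ⊗ 1_D)`. -/
def siteMat (d D : ℕ) [NeZero d] (U : Matrix.unitaryGroup (Fin d × Fin D) ℂ) (i : Fin d) :
    Matrix (Fin D) (Fin D) ℂ :=
  Matrix.of fun a b => (U : Matrix (Fin d × Fin D) (Fin d × Fin D) ℂ) (i, a) (0, b)

/-- The (unnormalized) matrix product state `ψ`, with periodic boundary conditions:
`ψ(i₁,…,iₙ) = Tr[A^{(1)}_{i₁} ⋯ A^{(n)}_{iₙ}]`. -/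
def mps (d D n : ℕ) [NeZero d] (U : Fin n → Matrix.unitaryGroup (Fin d × Fin D) ℂ) :
    (Fin n → Fin d) → ℂ :=
  fun idx => Matrix.trace (((List.finRange n).map fun m => siteMat d D (U m) (idx m)).prod)

/-- Merge a configuration on `A` with a configuration on `Aᶜ` into a full configuration. -/
def mergeCfg {n d : ℕ} (A : Finset (Fin n)) (x : (i : A) → Fin d)
    (z : (i : (Aᶜ : Finset (Fin n))) → Fin d) : Fin n → Fin d :=
  fun i => if h : i ∈ A then x ⟨i, h⟩ else z ⟨i, Finset.mem_compl.mpr h⟩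

/-- The (unnormalized) reduced density matrix `ρ_A = Tr_{A^c}[|ψ⟩⟨ψ|]` of a vector
`ψ ∈ (ℂ^d)^{⊗n}` on the sites in `A`. -/
def rhoA {n d : ℕ} (A : Finset (Fin n)) (ψ : (Fin n → Fin d) → ℂ) :
    Matrix ((i : A) → Fin d) ((i : A) → Fin d) ℂ :=
  Matrix.of fun x y =>
    ∑ z : (i : (Aᶜ : Finset (Fin n))) → Fin d, ψ (mergeCfg A x z) * conj (ψ (mergeCfg A y z))

/-- `η(x,y) := (x y² − x)/(x² y² − 1)`. -/
def etaF (x y : ℝ) : ℝ := (x * y ^ 2 - x) / (x ^ 2 * y ^ 2 - 1)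
set_option linter.unusedSimpArgs false
section Haar
variable {ι : Type*} [Fintype ι] [DecidableEq ι]

lemma meas_entry (r c : ι) :
    Measurable (fun U : Matrix.unitaryGroup ι ℂ => (U : Matrix ι ι ℂ) r c) := by
  have h1 : Measurable (fun U : Matrix.unitaryGroup ι ℂ => (U : Matrix ι ι ℂ)) :=
    measurable_subtype_coe
  have h2 : Measurable (fun M : Matrix ι ι ℂ => M r c) :=
    (measurable_pi_apply c).comp (measurable_pi_apply (X := fun _ : ι => ι → ℂ) r)
  exact h2.comp h1

lemma meas_mul (V : Matrix.unitaryGroup ι ℂ) :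
    Measurable (fun U : Matrix.unitaryGroup ι ℂ => V * U) := by
  refine Measurable.subtype_mk (f := fun U : Matrix.unitaryGroup ι ℂ => (V : Matrix ι ι ℂ) * (U : Matrix ι ι ℂ)) ?_
  refine measurable_pi_iff.2 fun r => measurable_pi_iff.2 fun c => ?_
  simp only [Matrix.mul_apply]
  exact Finset.measurable_sum _ fun i _ => (meas_entry i c).const_mul _

variable (μ : Measure (Matrix.unitaryGroup ι ℂ))

lemma inv_int (hμ : ∀ V : Matrix.unitaryGroup ι ℂ, μ.map (fun U => V * U) = μ)
    (f : Matrix.unitaryGroup ι ℂ → ℂ) (hf : Measurable f) (V : Matrix.unitaryGroup ι ℂ) :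
    ∫ U, f (V * U) ∂μ = ∫ U, f U ∂μ := by
  conv_rhs => rw [← hμ V]
  rw [integral_map (meas_mul V).aemeasurable hf.aestronglyMeasurable]

/-- quartic monomial -/
def quart (r₁ r₂ r₃ r₄ c₁ c₂ c₃ c₄ : ι) (U : Matrix.unitaryGroup ι ℂ) : ℂ :=
  (U : Matrix ι ι ℂ) r₁ c₁ * (U : Matrix ι ι ℂ) r₂ c₂ *
    (conj ((U : Matrix ι ι ℂ) r₃ c₃) * conj ((U : Matrix ι ι ℂ) r₄ c₄))

lemma meas_quart (r₁ r₂ r₃ r₄ c₁ c₂ c₃ c₄ : ι) :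
    Measurable (quart r₁ r₂ r₃ r₄ c₁ c₂ c₃ c₄) := by
  have hc : Measurable (fun z : ℂ => conj z) := Complex.continuous_conj.measurable
  exact ((meas_entry _ _).mul (meas_entry _ _)).mul
    ((hc.comp (meas_entry _ _)).mul (hc.comp (meas_entry _ _)))

lemma entry_le (U : Matrix.unitaryGroup ι ℂ) (r c : ι) : ‖(U : Matrix ι ι ℂ) r c‖ ≤ 1 :=
  entry_norm_bound_of_unitary U.2 r c

lemma quart_le (r₁ r₂ r₃ r₄ c₁ c₂ c₃ c₄ : ι) (U : Matrix.unitaryGroup ι ℂ) :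
    ‖quart r₁ r₂ r₃ r₄ c₁ c₂ c₃ c₄ U‖ ≤ 1 := by
  unfold quart
  simp only [norm_mul, RCLike.norm_conj]
  have := entry_le U
  exact mul_le_one₀ (mul_le_one₀ (this _ _) (norm_nonneg _) (this _ _)) (by positivity)
    (mul_le_one₀ (this _ _) (norm_nonneg _) (this _ _))

lemma integ_quart [IsProbabilityMeasure μ] (r₁ r₂ r₃ r₄ c₁ c₂ c₃ c₄ : ι) :
    Integrable (quart r₁ r₂ r₃ r₄ c₁ c₂ c₃ c₄) μ :=
  Integrable.of_bound (meas_quart _ _ _ _ _ _ _ _).aestronglyMeasurable 1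
    (Filter.Eventually.of_forall fun U => quart_le _ _ _ _ _ _ _ _ U)

/-- Phase unitary -/
lemma phase_mem (s : ι) : Matrix.diagonal (fun r : ι => if r = s then Complex.I else 1) ∈
    Matrix.unitaryGroup ι ℂ := by
  rw [Matrix.mem_unitaryGroup_iff, star_eq_conjTranspose, Matrix.diagonal_conjTranspose,
    Matrix.diagonal_mul_diagonal, ← Matrix.diagonal_one]
  congr 1
  funext r
  by_cases h : r = s <;> simp [h]

/-- Reflection -/
lemma refl_mem (s t : ι) (hst : s ≠ t) (x y τ : ℝ) (h : τ * (x ^ 2 + y ^ 2) = 2) :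
    (1 : Matrix ι ι ℂ) - (τ : ℂ) • Matrix.vecMulVec
      (Pi.single s (x : ℂ) + Pi.single t (y : ℂ)) (Pi.single s (x : ℂ) + Pi.single t (y : ℂ)) ∈
    Matrix.unitaryGroup ι ℂ := by
  set w : ι → ℂ := Pi.single s (x : ℂ) + Pi.single t (y : ℂ) with hw
  have hst' : star w = w := by
    funext r
    simp only [hw, Pi.star_apply, Pi.add_apply, Pi.single_apply]
    split_ifs <;> simp
  have hww : w ⬝ᵥ w = x ^ 2 + y ^ 2 := by
    simp [hw, dotProduct_add, add_dotProduct, hst, hst.symm]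
    ring
  have hh : (τ : ℂ) * (x ^ 2 + y ^ 2) = 2 := by exact_mod_cast h
  rw [Matrix.mem_unitaryGroup_iff, star_eq_conjTranspose, Matrix.conjTranspose_sub,
    Matrix.conjTranspose_smul, Matrix.conjTranspose_one, Matrix.conjTranspose_vecMulVec, hst']
  simp only [sub_mul, mul_sub, one_mul, mul_one, Matrix.smul_mul, Matrix.mul_smul,
    Matrix.vecMulVec_mul_vecMulVec, hww]
  ext i j
  simp [Matrix.vecMulVec_apply]
  linear_combination (τ : ℂ) * w i * w j * hh

lemma quart_phase (hμ : ∀ V : Matrix.unitaryGroup ι ℂ, μ.map (fun U => V * U) = μ)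
    (r₁ r₂ r₃ r₄ c₁ c₂ c₃ c₄ s : ι) :
    (if r₁ = s then Complex.I else 1) * (if r₂ = s then Complex.I else 1) *
      ((if r₃ = s then -Complex.I else 1) * (if r₄ = s then -Complex.I else 1)) *
      ∫ U, quart r₁ r₂ r₃ r₄ c₁ c₂ c₃ c₄ U ∂μ = ∫ U, quart r₁ r₂ r₃ r₄ c₁ c₂ c₃ c₄ U ∂μ := by
  conv_rhs => rw [← inv_int μ hμ _ (meas_quart _ _ _ _ _ _ _ _) ⟨_, phase_mem s⟩]
  rw [← integral_const_mul]
  congr 1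
  funext U
  simp only [quart, Submonoid.coe_mul, Matrix.diagonal_mul, map_mul]
  have h (r : ι) : conj (if r = s then Complex.I else 1) = if r = s then -Complex.I else 1 := by
    split_ifs <;> simp
  rw [h, h]
  ring

lemma quart_zero (hμ : ∀ V : Matrix.unitaryGroup ι ℂ, μ.map (fun U => V * U) = μ)
    (r₁ r₂ r₃ r₄ c₁ c₂ c₃ c₄ : ι) (h : ¬ ((r₁ = r₃ ∧ r₂ = r₄) ∨ (r₁ = r₄ ∧ r₂ = r₃))) :
    ∫ U, quart r₁ r₂ r₃ r₄ c₁ c₂ c₃ c₄ U ∂μ = 0 := by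
  have h1 := quart_phase μ hμ r₁ r₂ r₃ r₄ c₁ c₂ c₃ c₄ r₁
  have h2 := quart_phase μ hμ r₁ r₂ r₃ r₄ c₁ c₂ c₃ c₄ r₂
  generalize (∫ U, quart r₁ r₂ r₃ r₄ c₁ c₂ c₃ c₄ U ∂μ) = X at h1 h2
  have hI : Complex.I * X = X → X = 0 := by
    intro hh
    have : (Complex.I - 1) * X = 0 := by linear_combination hh
    rcases mul_eq_zero.1 this with h | h
    · have := congrArg Complex.re h
      norm_num at this
    · exact h
  have hm : -X = X → X = 0 := by
    intro hh
    linear_combination (-1/2 : ℂ) * hh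
  by_cases a : r₁ = r₃
  · subst a
    have e : r₄ ≠ r₂ := fun e => h (Or.inl ⟨rfl, e.symm⟩)
    by_cases f : r₁ = r₂
    · subst f
      simp [e] at h2
      exact hI h2
    · simp [e, f] at h2
      exact hI (by linear_combination h2)
  · by_cases b : r₁ = r₄
    · subst b
      have e : r₃ ≠ r₂ := fun e => h (Or.inr ⟨rfl, e.symm⟩)
      by_cases f : r₁ = r₂
      · subst f
        simp [e] at h2
        exact hI h2
      · simp [e, f] at h2
        exact hI (by linear_combination h2)
    · by_cases f : r₂ = r₁
      · simp [f, Ne.symm a, Ne.symm b] at h1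
        exact hm (by linear_combination h1)
      · simp [f, Ne.symm a, Ne.symm b] at h1
        exact hI (by linear_combination h1)

/-- Action of the reflection. -/
lemma quart_refl (hμ : ∀ V : Matrix.unitaryGroup ι ℂ, μ.map (fun U => V * U) = μ)
    (s t : ι) (hst : s ≠ t) (x y τ : ℝ) (h : τ * (x ^ 2 + y ^ 2) = 2)
    (r₁ r₂ r₃ r₄ c₁ c₂ c₃ c₄ : ι) :
    ∃ V : Matrix.unitaryGroup ι ℂ,
    (∀ U : Matrix.unitaryGroup ι ℂ, ∀ r c : ι, ((V * U : Matrix.unitaryGroup ι ℂ) : Matrix ι ι ℂ) r c =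
      (U : Matrix ι ι ℂ) r c - τ * ((if r = s then (x : ℂ) else 0) + (if r = t then (y : ℂ) else 0)) *
        (x * (U : Matrix ι ι ℂ) s c + y * (U : Matrix ι ι ℂ) t c)) ∧
    ∫ U, quart r₁ r₂ r₃ r₄ c₁ c₂ c₃ c₄ (V * U) ∂μ = ∫ U, quart r₁ r₂ r₃ r₄ c₁ c₂ c₃ c₄ U ∂μ := by
  refine ⟨⟨_, refl_mem s t hst x y τ h⟩, ?_, inv_int μ hμ _ (meas_quart _ _ _ _ _ _ _ _) _⟩
  intro U r c
  simp only [Submonoid.coe_mul, sub_mul, one_mul, Matrix.sub_apply, Matrix.smul_mul,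
    Matrix.smul_apply, Matrix.vecMulVec_mul, smul_eq_mul, Matrix.vecMulVec_apply, Pi.add_apply,
    Pi.single_apply, Matrix.add_vecMul, Matrix.single_vecMul]
  simp [mul_assoc]

lemma quart_swap (hμ : ∀ V : Matrix.unitaryGroup ι ℂ, μ.map (fun U => V * U) = μ)
    (s t r₁ r₂ r₃ r₄ c₁ c₂ c₃ c₄ : ι) :
    ∫ U, quart (Equiv.swap s t r₁) (Equiv.swap s t r₂) (Equiv.swap s t r₃) (Equiv.swap s t r₄)
      c₁ c₂ c₃ c₄ U ∂μ = ∫ U, quart r₁ r₂ r₃ r₄ c₁ c₂ c₃ c₄ U ∂μ := by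
  by_cases hst : s = t
  · subst hst; simp
  obtain ⟨V, hV, hV2⟩ := quart_refl μ hμ s t hst 1 (-1) 1 (by norm_num) r₁ r₂ r₃ r₄ c₁ c₂ c₃ c₄
  rw [← hV2]
  have key (U : Matrix.unitaryGroup ι ℂ) (r c : ι) :
      ((V * U : Matrix.unitaryGroup ι ℂ) : Matrix ι ι ℂ) r c
        = (U : Matrix ι ι ℂ) (Equiv.swap s t r) c := by
    rw [hV]
    by_cases h1 : r = s
    · subst h1; simp [hst]
    by_cases h2 : r = t
    · subst h2; simp [h1]
    simp [h1, h2, Equiv.swap_apply_of_ne_of_ne]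
  simp only [quart, key]

lemma quart_rot [IsProbabilityMeasure μ]
    (hμ : ∀ V : Matrix.unitaryGroup ι ℂ, μ.map (fun U => V * U) = μ)
    (s t : ι) (hst : s ≠ t) (c₁ c₂ c₃ c₄ : ι) :
    ∫ U, quart s s s s c₁ c₂ c₃ c₄ U ∂μ =
      ∑ e : Bool × Bool × Bool × Bool,
        ((if e.1 then 3/5 else 4/5) * (if e.2.1 then 3/5 else 4/5) *
        (if e.2.2.1 then 3/5 else 4/5) * (if e.2.2.2 then 3/5 else 4/5) : ℂ) *
        ∫ U, quart (if e.1 then s else t) (if e.2.1 then s else t) (if e.2.2.1 then s else t)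
          (if e.2.2.2 then s else t) c₁ c₂ c₃ c₄ U ∂μ := by
  obtain ⟨V, hV, hV2⟩ := quart_refl μ hμ s t hst 1 (-2) (2/5) (by norm_num) s s s s c₁ c₂ c₃ c₄
  rw [← hV2]
  simp_rw [← integral_const_mul]
  rw [← integral_finsetSum _ (fun e _ => (integ_quart μ _ _ _ _ _ _ _ _).const_mul _)]
  congr 1
  funext U
  have key (c : ι) :
      ((V * U : Matrix.unitaryGroup ι ℂ) : Matrix ι ι ℂ) s c
        = 3/5 * (U : Matrix ι ι ℂ) s c + 4/5 * (U : Matrix ι ι ℂ) t c := by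
    rw [hV]
    simp [hst]
    ring
  simp only [quart, key, Fintype.sum_prod_type, Fintype.sum_bool, map_add, map_mul]
  simp only [map_div₀, map_ofNat, if_true, Bool.false_eq_true, if_false]
  ring

lemma quart_form [IsProbabilityMeasure μ]
    (hμ : ∀ V : Matrix.unitaryGroup ι ℂ, μ.map (fun U => V * U) = μ)
    (s₀ t₀ : ι) (h₀ : s₀ ≠ t₀) (c₁ c₂ c₃ c₄ : ι) :
    ∃ α β : ℂ, ∀ r₁ r₂ r₃ r₄ : ι, ∫ U, quart r₁ r₂ r₃ r₄ c₁ c₂ c₃ c₄ U ∂μ =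
      α * (if r₁ = r₃ ∧ r₂ = r₄ then 1 else 0) + β * (if r₁ = r₄ ∧ r₂ = r₃ then 1 else 0) := by
  have hz := fun r₁ r₂ r₃ r₄ => quart_zero μ hμ r₁ r₂ r₃ r₄ c₁ c₂ c₃ c₄
  have hs := fun s t r₁ r₂ r₃ r₄ => quart_swap μ hμ s t r₁ r₂ r₃ r₄ c₁ c₂ c₃ c₄
  have hr := fun s t hst => quart_rot μ hμ s t hst c₁ c₂ c₃ c₄
  generalize hX : (fun r₁ r₂ r₃ r₄ => ∫ U, quart r₁ r₂ r₃ r₄ c₁ c₂ c₃ c₄ U ∂μ) = X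
  have hX' : ∀ r₁ r₂ r₃ r₄, ∫ U, quart r₁ r₂ r₃ r₄ c₁ c₂ c₃ c₄ U ∂μ = X r₁ r₂ r₃ r₄ := by
    intros; rw [← hX]
  simp only [hX'] at hz hs hr ⊢
  have move (s t s' t' : ι) (h : s ≠ t) (h' : s' ≠ t') :
      ∃ π : ι ≃ ι, π s = s' ∧ π t = t' ∧ ∀ r₁ r₂ r₃ r₄, X (π r₁) (π r₂) (π r₃) (π r₄) = X r₁ r₂ r₃ r₄ := by
    have ht1 : Equiv.swap s s' t ≠ s' := by
      intro hh
      have : t = Equiv.swap s s' s' := ((Equiv.swap s s').symm_apply_apply t).symm.trans (by rw [hh]; simp)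
      rw [Equiv.swap_apply_right] at this
      exact h this.symm
    refine ⟨(Equiv.swap s s').trans (Equiv.swap (Equiv.swap s s' t) t'), ?_, ?_, ?_⟩
    · simp only [Equiv.trans_apply, Equiv.swap_apply_left]
      exact Equiv.swap_apply_of_ne_of_ne ht1.symm h'
    · simp
    · intro r₁ r₂ r₃ r₄
      simp only [Equiv.trans_apply, hs]
  have hα (s t : ι) (h : s ≠ t) : X s t s t = X s₀ t₀ s₀ t₀ := by
    obtain ⟨π, h1, h2, h3⟩ := move s₀ t₀ s t h₀ h
    rw [← h3 s₀ t₀ s₀ t₀, h1, h2]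
  have hβ (s t : ι) (h : s ≠ t) : X s t t s = X s₀ t₀ t₀ s₀ := by
    obtain ⟨π, h1, h2, h3⟩ := move s₀ t₀ s t h₀ h
    rw [← h3 s₀ t₀ t₀ s₀, h1, h2]
  have hγ (s : ι) : X s s s s = X s₀ s₀ s₀ s₀ := by
    have := hs s₀ s s₀ s₀ s₀ s₀
    simpa using this
  have hγ2 : X s₀ s₀ s₀ s₀ = X s₀ t₀ s₀ t₀ + X s₀ t₀ t₀ s₀ := by
    have := hr s₀ t₀ h₀
    simp only [Fintype.sum_prod_type, Fintype.sum_bool, if_true, Bool.false_eq_true, if_false] at this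
    rw [hz s₀ s₀ s₀ t₀ (by simp [h₀, h₀.symm]), hz s₀ s₀ t₀ s₀ (by simp [h₀, h₀.symm]),
      hz s₀ s₀ t₀ t₀ (by simp [h₀, h₀.symm]), hz s₀ t₀ s₀ s₀ (by simp [h₀, h₀.symm]),
      hz t₀ s₀ s₀ s₀ (by simp [h₀, h₀.symm]), hz t₀ t₀ s₀ s₀ (by simp [h₀, h₀.symm]),
      hz t₀ t₀ t₀ s₀ (by simp [h₀, h₀.symm]), hz t₀ t₀ s₀ t₀ (by simp [h₀, h₀.symm]),
      hz t₀ s₀ t₀ t₀ (by simp [h₀, h₀.symm]), hz s₀ t₀ t₀ t₀ (by simp [h₀, h₀.symm]),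
      hα t₀ s₀ h₀.symm, hβ t₀ s₀ h₀.symm, hγ t₀] at this
    linear_combination (625/288 : ℂ) * this
  refine ⟨X s₀ t₀ s₀ t₀, X s₀ t₀ t₀ s₀, fun r₁ r₂ r₃ r₄ => ?_⟩
  by_cases h12 : r₁ = r₂
  · subst h12
    by_cases h : r₁ = r₃ ∧ r₁ = r₄
    · obtain ⟨rfl, rfl⟩ := h
      simp [hγ, hγ2]
    · rw [hz _ _ _ _ (by tauto), if_neg (by tauto), if_neg (by tauto)]
      simp
  · by_cases h : r₁ = r₃ ∧ r₂ = r₄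
    · obtain ⟨rfl, rfl⟩ := h
      simp [hα _ _ h12, h12]
    · by_cases h' : r₁ = r₄ ∧ r₂ = r₃
      · obtain ⟨rfl, rfl⟩ := h'
        simp [hβ _ _ h12, h12]
      · rw [hz _ _ _ _ (by tauto), if_neg h, if_neg h']
        simp

lemma ite_mul_one' (p q : Prop) [Decidable p] [Decidable q] :
    (if p then (if q then (1 : ℂ) else 0) else 0) = (if p then 1 else 0) * (if q then 1 else 0) := by
  split_ifs <;> simp

lemma ortho (U : Matrix.unitaryGroup ι ℂ) (c c' : ι) :
    ∑ r, (U : Matrix ι ι ℂ) r c * conj ((U : Matrix ι ι ℂ) r c') = if c = c' then 1 else 0 := by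
  have h : star (U : Matrix ι ι ℂ) * (U : Matrix ι ι ℂ) = 1 := Matrix.mem_unitaryGroup_iff'.1 U.2
  have := congrFun (congrFun h c') c
  rw [Matrix.mul_apply, Matrix.one_apply] at this
  simp only [Matrix.star_apply] at this
  rw [if_congr (eq_comm (a := c)) rfl rfl, ← this]
  exact Finset.sum_congr rfl fun r _ => mul_comm _ _

/-- second-moment Weingarten formula -/
lemma quart_wg [IsProbabilityMeasure μ]
    (hμ : ∀ V : Matrix.unitaryGroup ι ℂ, μ.map (fun U => V * U) = μ)
    (hι : 1 < Fintype.card ι) (r₁ r₂ r₃ r₄ c₁ c₂ c₃ c₄ : ι) (q : ℂ) (hq : q = Fintype.card ι) :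
    ∫ U, quart r₁ r₂ r₃ r₄ c₁ c₂ c₃ c₄ U ∂μ =
      ((if c₁ = c₃ ∧ c₂ = c₄ then 1 else 0) / (q ^ 2 - 1)
        - (if c₁ = c₄ ∧ c₂ = c₃ then 1 else 0) / (q * (q ^ 2 - 1))) *
          (if r₁ = r₃ ∧ r₂ = r₄ then 1 else 0)
      + ((if c₁ = c₄ ∧ c₂ = c₃ then 1 else 0) / (q ^ 2 - 1)
        - (if c₁ = c₃ ∧ c₂ = c₄ then 1 else 0) / (q * (q ^ 2 - 1))) *
          (if r₁ = r₄ ∧ r₂ = r₃ then 1 else 0) := by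
  obtain ⟨s₀, t₀, h₀⟩ := Fintype.one_lt_card_iff.1 hι
  obtain ⟨α, β, hf⟩ := quart_form μ hμ s₀ t₀ h₀ c₁ c₂ c₃ c₄
  have e1 : α * q ^ 2 + β * q = if c₁ = c₃ ∧ c₂ = c₄ then 1 else 0 := by
    have h1 : ∑ s, ∑ t, ∫ U, quart s t s t c₁ c₂ c₃ c₄ U ∂μ
        = if c₁ = c₃ ∧ c₂ = c₄ then 1 else 0 := by
      simp_rw [← integral_finsetSum Finset.univ (fun t _ => integ_quart μ _ t _ t c₁ c₂ c₃ c₄)]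
      rw [← integral_finsetSum _ (fun s _ => integrable_finsetSum _
        (fun t _ => integ_quart μ s t s t c₁ c₂ c₃ c₄))]
      have : ∀ U : Matrix.unitaryGroup ι ℂ, ∑ s, ∑ t, quart s t s t c₁ c₂ c₃ c₄ U
          = if c₁ = c₃ ∧ c₂ = c₄ then 1 else 0 := by
        intro U
        rw [ite_and, ite_mul_one', ← ortho U c₁ c₃, ← ortho U c₂ c₄, Finset.sum_mul_sum]
        refine Finset.sum_congr rfl fun s _ => Finset.sum_congr rfl fun t _ => ?_
        simp only [quart]; ring
      simp only [this]
      simp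
    rw [← h1]
    simp only [hf, Finset.sum_add_distrib, ← Finset.mul_sum, ite_and]
    simp [hq]
    try ring_nf
    try simp
  have e2 : α * q + β * q ^ 2 = if c₁ = c₄ ∧ c₂ = c₃ then 1 else 0 := by
    have h1 : ∑ s, ∑ t, ∫ U, quart s t t s c₁ c₂ c₃ c₄ U ∂μ
        = if c₁ = c₄ ∧ c₂ = c₃ then 1 else 0 := by
      simp_rw [← integral_finsetSum Finset.univ (fun t _ => integ_quart μ _ t t _ c₁ c₂ c₃ c₄)]
      rw [← integral_finsetSum _ (fun s _ => integrable_finsetSum _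
        (fun t _ => integ_quart μ s t t s c₁ c₂ c₃ c₄))]
      have : ∀ U : Matrix.unitaryGroup ι ℂ, ∑ s, ∑ t, quart s t t s c₁ c₂ c₃ c₄ U
          = if c₁ = c₄ ∧ c₂ = c₃ then 1 else 0 := by
        intro U
        rw [ite_and, ite_mul_one', ← ortho U c₁ c₄, ← ortho U c₂ c₃, Finset.sum_mul_sum]
        refine Finset.sum_congr rfl fun s _ => Finset.sum_congr rfl fun t _ => ?_
        simp only [quart]; ring
      simp only [this]
      simp
    rw [← h1]
    simp only [hf, Finset.sum_add_distrib, ← Finset.mul_sum, ite_and]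
    simp [hq]
    try ring_nf
    try simp
  have hq0 : q ≠ 0 := by
    rw [hq]; exact_mod_cast (by omega : Fintype.card ι ≠ 0)
  have hq1 : q ^ 2 - 1 ≠ 0 := by
    rw [hq]
    have : (1 : ℝ) < Fintype.card ι := by exact_mod_cast hι
    have h2 : ((Fintype.card ι : ℝ) ^ 2 - 1) ≠ 0 := by nlinarith
    exact_mod_cast h2
  rw [hf, ← e1, ← e2]
  congr 2
  · field_simp; ring
  · field_simp; ring

lemma quad_wg [IsProbabilityMeasure μ]
    (hμ : ∀ V : Matrix.unitaryGroup ι ℂ, μ.map (fun U => V * U) = μ)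
    (hι : 1 < Fintype.card ι) (r r' c c' : ι) (q : ℂ) (hq : q = Fintype.card ι) :
    ∫ U : Matrix.unitaryGroup ι ℂ, (U : Matrix ι ι ℂ) r c * conj ((U : Matrix ι ι ℂ) r' c') ∂μ =
      (if c = c' then 1 else 0) * (if r = r' then 1 else 0) / q := by
  have hq0 : q ≠ 0 := by
    rw [hq]; exact_mod_cast (by omega : Fintype.card ι ≠ 0)
  have hq1 : q ^ 2 - 1 ≠ 0 := by
    rw [hq]
    have : (1 : ℝ) < Fintype.card ι := by exact_mod_cast hι
    have h2 : ((Fintype.card ι : ℝ) ^ 2 - 1) ≠ 0 := by nlinarith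
    exact_mod_cast h2
  have h1 : ∀ U : Matrix.unitaryGroup ι ℂ,
      (U : Matrix ι ι ℂ) r c * conj ((U : Matrix ι ι ℂ) r' c')
        = ∑ s, quart r s r' s c r c' r U := by
    intro U
    have := ortho U r r
    rw [if_pos rfl] at this
    rw [← mul_one (_ * _), ← this, Finset.mul_sum]
    refine Finset.sum_congr rfl fun t _ => ?_
    simp only [quart]; ring
  simp only [h1]
  rw [integral_finsetSum _ (fun s _ => integ_quart μ r s r' s c r c' r)]
  simp only [quart_wg μ hμ hι _ _ _ _ _ _ _ _ q hq, Finset.sum_add_distrib, ← Finset.mul_sum]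
  have e1 : ∑ i : ι, (if r = r' ∧ True then (1 : ℂ) else 0) = q * if r = r' then 1 else 0 := by
    simp [hq]
  have e2 : ∑ i : ι, (if r = i ∧ i = r' then (1 : ℂ) else 0) = if r = r' then 1 else 0 := by
    simp [ite_and]
  rw [e1, e2]
  simp only [and_true]
  field_simp
  ring
end Haar
section Lists
open scoped Kronecker

lemma path_exists {ι : Type} [Fintype ι] [DecidableEq ι] (n : ℕ) : ∀ (a b : ι),
    ∃ (κ : Type) (_ : Fintype κ) (i j : κ → Fin n → ι), ∀ M : Fin n → Matrix ι ι ℂ,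
      ((List.finRange n).map M).prod a b = ∑ k, ∏ m, M m (i k m) (j k m) := by
  induction n with
  | zero =>
    intro a b
    refine ⟨PLift (a = b), inferInstance, fun _ => Fin.elim0, fun _ => Fin.elim0, fun M => ?_⟩
    simp only [List.finRange_zero, List.map_nil, List.prod_nil, Matrix.one_apply,
      Finset.univ_eq_empty, Finset.prod_empty, Finset.sum_const, Finset.card_univ]
    by_cases h : a = b
    · have : Unique (PLift (a = b)) := ⟨⟨⟨h⟩⟩, fun _ => rfl⟩
      simp [h]
    · have : IsEmpty (PLift (a = b)) := ⟨fun x => h x.down⟩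
      simp [h]
  | succ n ih =>
    intro a b
    choose κ hκ i j h using fun c => ih c b
    refine ⟨Σ c, κ c, inferInstance, fun x => Fin.cons a (i x.1 x.2), fun x => Fin.cons x.1 (j x.1 x.2),
      fun M => ?_⟩
    rw [List.finRange_succ, List.map_cons, List.prod_cons, List.map_map, Matrix.mul_apply,
      Fintype.sum_sigma]
    refine Finset.sum_congr rfl fun c _ => ?_
    rw [h c, Finset.mul_sum]
    refine Finset.sum_congr rfl fun k _ => ?_
    rw [Fin.prod_univ_succ]
    simp

lemma E_list {ι : Type} [Fintype ι] [DecidableEq ι] {Ω : Type*} [MeasurableSpace Ω] (μ : Measure Ω)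
    [IsProbabilityMeasure μ] (n : ℕ) (F : Fin n → Ω → Matrix ι ι ℂ)
    (hF : ∀ m a b, Integrable (fun u => F m u a b) μ) (a b : ι) :
    Integrable (fun U : Fin n → Ω => ((List.finRange n).map fun m => F m (U m)).prod a b)
      (Measure.pi fun _ => μ) ∧
    ∫ U : Fin n → Ω, ((List.finRange n).map fun m => F m (U m)).prod a b ∂(Measure.pi fun _ => μ) =
      ((List.finRange n).map fun m => (Matrix.of fun a b => ∫ u, F m u a b ∂μ : Matrix ι ι ℂ)).prod a b := by
  obtain ⟨κ, hκ, i, j, h⟩ := path_exists n a b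
  have hi : ∀ k, Integrable (fun U : Fin n → Ω => ∏ m, F m (U m) (i k m) (j k m))
      (Measure.pi fun _ => μ) := fun k =>
    Integrable.fintype_prod (f := fun m u => F m u (i k m) (j k m)) (fun m => hF m _ _)
  simp only [h]
  refine ⟨integrable_finsetSum _ fun k _ => hi k, ?_⟩
  rw [integral_finsetSum _ fun k _ => hi k]
  refine Finset.sum_congr rfl fun k _ => ?_
  rw [integral_fintype_prod_eq_prod (f := fun m u => F m u (i k m) (j k m))]
  rfl

lemma E_trace {ι : Type} [Fintype ι] [DecidableEq ι] {Ω : Type*} [MeasurableSpace Ω] (μ : Measure Ω)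
    [IsProbabilityMeasure μ] (n : ℕ) (F : Fin n → Ω → Matrix ι ι ℂ)
    (hF : ∀ m a b, Integrable (fun u => F m u a b) μ) :
    Integrable (fun U : Fin n → Ω => ((List.finRange n).map fun m => F m (U m)).prod.trace)
      (Measure.pi fun _ => μ) ∧
    ∫ U : Fin n → Ω, ((List.finRange n).map fun m => F m (U m)).prod.trace ∂(Measure.pi fun _ => μ) =
      ((List.finRange n).map fun m => (Matrix.of fun a b => ∫ u, F m u a b ∂μ : Matrix ι ι ℂ)).prod.trace := by
  simp only [Matrix.trace, Matrix.diag]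
  refine ⟨integrable_finsetSum _ fun k _ => (E_list μ n F hF k k).1, ?_⟩
  rw [integral_finsetSum _ fun k _ => (E_list μ n F hF k k).1]
  exact Finset.sum_congr rfl fun k _ => (E_list μ n F hF k k).2

lemma sum_list_prod {R : Type*} [Semiring R] {κ : Type*} [Fintype κ] (n : ℕ) :
    ∀ (Q : Fin n → κ → R), ∑ X : Fin n → κ, ((List.finRange n).map fun m => Q m (X m)).prod =
      ((List.finRange n).map fun m => ∑ i, Q m i).prod := by
  induction n with
  | zero => intro Q; simp
  | succ n ih =>
    intro Q
    rw [← (Fin.consEquiv (fun _ : Fin (n+1) => κ)).sum_comp, Fintype.sum_prod_type]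
    simp only [List.finRange_succ, List.map_cons, List.prod_cons, List.map_map, Function.comp_def]
    rw [← ih fun m => Q m.succ, Finset.sum_mul_sum]
    simp [Fin.consEquiv]

lemma kron_list {α β γ : Type*} [Fintype β] [DecidableEq β] [Fintype γ] [DecidableEq γ]
    (l : List α) (f : α → Matrix β β ℂ) (g : α → Matrix γ γ ℂ) :
    (l.map f).prod ⊗ₖ (l.map g).prod = (l.map fun x => f x ⊗ₖ g x).prod := by
  induction l with
  | nil => simp
  | cons x l ih => simp [← ih, Matrix.mul_kronecker_mul]

lemma conj_list {α β : Type*} [Fintype β] [DecidableEq β] (l : List α) (f : α → Matrix β β ℂ) :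
    conj (l.map f).prod.trace = (l.map fun x => (f x).map conj).prod.trace := by
  have : (l.map fun x => (f x).map conj).prod = (l.map f).prod.map conj := by
    have := map_list_prod ((starRingEnd ℂ).mapMatrix (m := β)) (l.map f)
    rw [List.map_map] at this
    exact this.symm
  rw [this]
  simp [Matrix.trace, map_sum]

lemma sandwich_list {α β γ : Type*} [Fintype β] [DecidableEq β] [Fintype γ] [DecidableEq γ]
    (S : Matrix β γ ℂ) (W : α → Matrix γ γ ℂ) (l : List α) :
    Sᵀ * (l.map fun x => S * W x * Sᵀ).prod = (l.map fun x => Sᵀ * S * W x).prod * Sᵀ := by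
  induction l with
  | nil => simp
  | cons x l ih =>
    simp only [List.map_cons, List.prod_cons]
    simp only [Matrix.mul_assoc] at ih ⊢
    rw [ih]

lemma sandwich_trace {α β γ : Type*} [Fintype β] [DecidableEq β] [Fintype γ] [DecidableEq γ]
    (S : Matrix β γ ℂ) (W : α → Matrix γ γ ℂ) (l : List α) (hl : l ≠ []) :
    (l.map fun x => S * W x * Sᵀ).prod.trace = (l.map fun x => Sᵀ * S * W x).prod.trace := by
  obtain ⟨x, l, rfl⟩ := List.exists_cons_of_ne_nil hl
  simp only [List.map_cons, List.prod_cons]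
  rw [Matrix.mul_assoc, sandwich_list, Matrix.trace_mul_comm (S * W x), Matrix.mul_assoc _ Sᵀ,
    Matrix.trace_mul_comm]
  simp only [Matrix.mul_assoc]
end Lists
section Moments
open scoped Kronecker

def mixCfg {n d : ℕ} (A : Finset (Fin n)) (X Y : Fin n → Fin d) : Fin n → Fin d :=
  fun i => if i ∈ A then Y i else X i

def PA {n d : ℕ} (A : Finset (Fin n)) (ψ : (Fin n → Fin d) → ℂ) : ℂ :=
  ∑ X, ∑ Y, (ψ X * ψ Y) * (conj (ψ (mixCfg A X Y)) * conj (ψ (mixCfg A Y X)))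

variable (d D : ℕ) [NeZero d]

def siteQ (U : Matrix.unitaryGroup (Fin d × Fin D) ℂ) (p : Prop) [Decidable p]
    (x : Fin d × Fin d) :
    Matrix ((Fin D × Fin D) × (Fin D × Fin D)) ((Fin D × Fin D) × (Fin D × Fin D)) ℂ :=
  (siteMat d D U x.1 ⊗ₖ siteMat d D U x.2) ⊗ₖ
    ((siteMat d D U (if p then x.2 else x.1)).map conj ⊗ₖ
      (siteMat d D U (if p then x.1 else x.2)).map conj)

lemma PA_eq (n : ℕ) (A : Finset (Fin n)) (U : Fin n → Matrix.unitaryGroup (Fin d × Fin D) ℂ) :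
    PA A (mps d D n U) =
      ((List.finRange n).map fun m => ∑ x, siteQ d D (U m) (m ∈ A) x).prod.trace := by
  rw [← sum_list_prod, ← (Equiv.arrowProdEquivProdArrow (Fin n) (fun _ => Fin d) (fun _ => Fin d)).symm.sum_comp,
    Fintype.sum_prod_type, Matrix.trace_sum]
  unfold PA
  refine Finset.sum_congr rfl fun X _ => ?_
  rw [Matrix.trace_sum]
  refine Finset.sum_congr rfl fun Y _ => ?_
  unfold mps siteQ
  rw [conj_list, conj_list, ← Matrix.trace_kronecker, ← Matrix.trace_kronecker,
    ← Matrix.trace_kronecker, kron_list, kron_list, kron_list]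
  rfl

lemma siteQ_apply (U : Matrix.unitaryGroup (Fin d × Fin D) ℂ) (p : Prop) [Decidable p]
    (x : Fin d × Fin d) (a b : (Fin D × Fin D) × (Fin D × Fin D)) :
    siteQ d D U p x a b =
      quart (x.1, a.1.1) (x.2, a.1.2) ((if p then x.2 else x.1), a.2.1)
        ((if p then x.1 else x.2), a.2.2) (0, b.1.1) (0, b.1.2) (0, b.2.1) (0, b.2.2) U := by
  simp [siteQ, quart, Matrix.kroneckerMap_apply, siteMat]

def Smat : Matrix ((Fin D × Fin D) × (Fin D × Fin D)) (Fin 2) ℂ :=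
  Matrix.of fun x σ => if σ = 0 then (if x.1.1 = x.2.1 ∧ x.1.2 = x.2.2 then 1 else 0)
    else (if x.1.1 = x.2.2 ∧ x.1.2 = x.2.1 then 1 else 0)

def Wmat (q p₀ p₁ : ℂ) : Matrix (Fin 2) (Fin 2) ℂ :=
  !![p₀ / (q ^ 2 - 1), -(p₀ / (q * (q ^ 2 - 1))); -(p₁ / (q * (q ^ 2 - 1))), p₁ / (q ^ 2 - 1)]

lemma SW_apply (q p₀ p₁ : ℂ) (a b : (Fin D × Fin D) × (Fin D × Fin D)) :
    (Smat D * Wmat q p₀ p₁ * (Smat D)ᵀ) a b =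
      ((if b.1.1 = b.2.1 ∧ b.1.2 = b.2.2 then 1 else 0) / (q ^ 2 - 1)
        - (if b.1.1 = b.2.2 ∧ b.1.2 = b.2.1 then 1 else 0) / (q * (q ^ 2 - 1))) *
          (p₀ * if a.1.1 = a.2.1 ∧ a.1.2 = a.2.2 then 1 else 0)
      + ((if b.1.1 = b.2.2 ∧ b.1.2 = b.2.1 then 1 else 0) / (q ^ 2 - 1)
        - (if b.1.1 = b.2.1 ∧ b.1.2 = b.2.2 then 1 else 0) / (q * (q ^ 2 - 1))) *
          (p₁ * if a.1.1 = a.2.2 ∧ a.1.2 = a.2.1 then 1 else 0) := by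
  rw [Matrix.mul_apply, Fin.sum_univ_two, Matrix.mul_apply, Matrix.mul_apply, Fin.sum_univ_two,
    Fin.sum_univ_two, Matrix.transpose_apply, Matrix.transpose_apply]
  have h0 : ∀ x, Smat D x 0 = (if x.1.1 = x.2.1 ∧ x.1.2 = x.2.2 then 1 else 0) := fun x => rfl
  have h1 : ∀ x, Smat D x 1 = (if x.1.1 = x.2.2 ∧ x.1.2 = x.2.1 then 1 else 0) := fun x => rfl
  have w00 : Wmat q p₀ p₁ 0 0 = p₀ / (q ^ 2 - 1) := rfl
  have w01 : Wmat q p₀ p₁ 0 1 = -(p₀ / (q * (q ^ 2 - 1))) := rfl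
  have w10 : Wmat q p₀ p₁ 1 0 = -(p₁ / (q * (q ^ 2 - 1))) := rfl
  have w11 : Wmat q p₀ p₁ 1 1 = p₁ / (q ^ 2 - 1) := rfl
  rw [h0, h1, h0, h1, w00, w01, w10, w11]
  ring

lemma SS : (Smat D)ᵀ * Smat D = !![(D : ℂ) ^ 2, D; D, (D : ℂ) ^ 2] := by
  ext i j
  fin_cases i <;> fin_cases j <;>
    simp [Matrix.mul_apply, Smat, Fintype.sum_prod_type, ite_and, pow_two]

def TA (a b : ℝ) : Matrix (Fin 2) (Fin 2) ℝ := !![a, b; 0, 1]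
def TB (a b : ℝ) : Matrix (Fin 2) (Fin 2) ℝ := !![1, 0; b, a]

lemma q_ne {d D : ℕ} (hd : 2 ≤ d) (hD : 2 ≤ D) : ((d : ℂ) ^ 2 * (D : ℂ) ^ 2 - 1) ≠ 0 := by
  have h : (d : ℤ) ^ 2 * (D : ℤ) ^ 2 - 1 ≠ 0 := by
    have h1 : 4 ≤ d ^ 2 := by nlinarith
    have h2 : 4 ≤ D ^ 2 := by nlinarith
    have h3 : 16 ≤ d ^ 2 * D ^ 2 := Nat.mul_le_mul h1 h2
    have : (16 : ℤ) ≤ (d : ℤ) ^ 2 * (D : ℤ) ^ 2 := by exact_mod_cast h3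
    omega
  exact_mod_cast h

lemma SW_B (hd : 2 ≤ d) (hD : 2 ≤ D) :
    (Smat D)ᵀ * Smat D * Wmat ((d : ℂ) * D) ((d : ℂ) ^ 2) d =
      (TB (etaF d D) (etaF D d)).map Complex.ofRealHom := by
  have h1 := q_ne hd hD
  have h2 : (d : ℂ) ≠ 0 := by exact_mod_cast (by omega : d ≠ 0)
  have h3 : (D : ℂ) ≠ 0 := by exact_mod_cast (by omega : D ≠ 0)
  have h1' : ((D : ℂ) ^ 2 * (d : ℂ) ^ 2 - 1) ≠ 0 := by rw [mul_comm]; exact h1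
  have h4 : (((d : ℂ) * D) ^ 2 - 1) ≠ 0 := by rw [mul_pow]; exact h1
  rw [SS, Wmat, TB]
  ext i j
  fin_cases i <;> fin_cases j <;>
    simp [Matrix.mul_apply, Fin.sum_univ_two, etaF] <;> field_simp <;> ring

lemma SW_A (hd : 2 ≤ d) (hD : 2 ≤ D) :
    (Smat D)ᵀ * Smat D * Wmat ((d : ℂ) * D) d ((d : ℂ) ^ 2) =
      (TA (etaF d D) (etaF D d)).map Complex.ofRealHom := by
  have h1 := q_ne hd hD
  have h2 : (d : ℂ) ≠ 0 := by exact_mod_cast (by omega : d ≠ 0)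
  have h3 : (D : ℂ) ≠ 0 := by exact_mod_cast (by omega : D ≠ 0)
  have h1' : ((D : ℂ) ^ 2 * (d : ℂ) ^ 2 - 1) ≠ 0 := by rw [mul_comm]; exact h1
  have h4 : (((d : ℂ) * D) ^ 2 - 1) ≠ 0 := by rw [mul_pow]; exact h1
  rw [SS, Wmat, TA]
  ext i j
  fin_cases i <;> fin_cases j <;>
    simp [Matrix.mul_apply, Fin.sum_univ_two, etaF] <;> field_simp <;> ring

variable (μ : Measure (Matrix.unitaryGroup (Fin d × Fin D) ℂ)) [IsProbabilityMeasure μ]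

lemma E_site (hd : 2 ≤ d) (hD : 2 ≤ D)
    (hμ : ∀ V : Matrix.unitaryGroup (Fin d × Fin D) ℂ, μ.map (fun U => V * U) = μ)
    (p : Prop) [Decidable p] :
    (Matrix.of fun a b => ∫ u, (∑ x, siteQ d D u p x) a b ∂μ) =
      Smat D * Wmat ((d : ℂ) * D) (if p then (d : ℂ) else (d : ℂ) ^ 2)
        (if p then (d : ℂ) ^ 2 else d) * (Smat D)ᵀ := by
  have hcard : 1 < Fintype.card (Fin d × Fin D) := by
    simp; nlinarith
  ext a b
  rw [SW_apply, Matrix.of_apply]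
  simp only [Matrix.sum_apply, siteQ_apply]
  rw [integral_finsetSum _ fun x _ => integ_quart μ _ _ _ _ _ _ _ _]
  simp only [quart_wg μ hμ hcard _ _ _ _ _ _ _ _ ((d : ℂ) * D) (by simp), Finset.sum_add_distrib,
    ← Finset.mul_sum, Prod.mk.injEq, true_and]
  congr 2
  · by_cases h : p
    · simp only [h, if_true, Fintype.sum_prod_type]
      by_cases h2 : a.1.1 = a.2.1 ∧ a.1.2 = a.2.2
      · simp [h2, ite_and, pow_two]
      · rw [if_neg h2, Finset.sum_eq_zero, mul_zero]
        intro x _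
        refine Finset.sum_eq_zero fun y _ => if_neg (by tauto)
    · simp only [h, if_false, Fintype.sum_prod_type]
      simp [pow_two]
  · by_cases h : p
    · simp only [h, if_true, Fintype.sum_prod_type]
      simp [pow_two]
    · simp only [h, if_false, Fintype.sum_prod_type]
      by_cases h2 : a.1.1 = a.2.2 ∧ a.1.2 = a.2.1
      · simp [h2, ite_and, pow_two]
      · rw [if_neg h2, Finset.sum_eq_zero, mul_zero]
        intro x _
        refine Finset.sum_eq_zero fun y _ => if_neg (by tauto)

def Tprod (n : ℕ) (A : Finset (Fin n)) : Matrix (Fin 2) (Fin 2) ℝ :=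
  ((List.finRange n).map fun m => if m ∈ A then TA (etaF d D) (etaF D d)
    else TB (etaF d D) (etaF D d)).prod

lemma E_PA (hd : 2 ≤ d) (hD : 2 ≤ D)
    (hμ : ∀ V : Matrix.unitaryGroup (Fin d × Fin D) ℂ, μ.map (fun U => V * U) = μ)
    (n : ℕ) (hn : n ≠ 0) (A : Finset (Fin n)) :
    Integrable (fun U => PA A (mps d D n U)) (Measure.pi fun _ => μ) ∧
    ∫ U, PA A (mps d D n U) ∂(Measure.pi fun _ => μ) = ((Tprod d D n A).trace : ℂ) := by
  have hE := E_trace μ n (fun m u => ∑ x, siteQ d D u (m ∈ A) x) (by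
    intro m a b
    simp only [Matrix.sum_apply, siteQ_apply]
    exact integrable_finsetSum _ fun x _ => integ_quart μ _ _ _ _ _ _ _ _)
  simp only [PA_eq]
  refine ⟨hE.1, hE.2.trans ?_⟩
  simp only [E_site d D μ hd hD hμ]
  rw [sandwich_trace _ (fun m : Fin n => Wmat ((d : ℂ) * D) (if m ∈ A then (d : ℂ) else (d : ℂ) ^ 2)
        (if m ∈ A then (d : ℂ) ^ 2 else d)) _ (by simpa using hn)]
  have h2 : ∀ m : Fin n, (Smat D)ᵀ * Smat D * Wmat ((d : ℂ) * D)
      (if m ∈ A then (d : ℂ) else (d : ℂ) ^ 2) (if m ∈ A then (d : ℂ) ^ 2 else d) =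
      (if m ∈ A then TA (etaF d D) (etaF D d) else TB (etaF d D) (etaF D d)).map Complex.ofRealHom := by
    intro m
    split_ifs
    · exact SW_A d D hd hD
    · exact SW_B d D hd hD
  simp only [h2, Tprod]
  have := map_list_prod (Complex.ofRealHom.mapMatrix (m := Fin 2))
    ((List.finRange n).map fun m => if m ∈ A then TA (etaF d D) (etaF D d)
      else TB (etaF d D) (etaF D d))
  rw [List.map_map] at this
  rw [show (fun m : Fin n => (if m ∈ A then TA (etaF d D) (etaF D d)
      else TB (etaF d D) (etaF D d)).map Complex.ofRealHom) = (Complex.ofRealHom.mapMatrix (m := Fin 2)) ∘ (fun m : Fin n => (if m ∈ A then TA (etaF d D) (etaF D d)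
      else TB (etaF d D) (etaF D d))) from rfl, ← this]
  simp [Matrix.trace]

/-- squared norm -/
def nrm {n d : ℕ} (ψ : (Fin n → Fin d) → ℂ) : ℝ := ∑ x, ‖ψ x‖ ^ 2

lemma nrm_eq {n d : ℕ} (ψ : (Fin n → Fin d) → ℂ) : (nrm ψ : ℂ) = ∑ x, ψ x * conj (ψ x) := by
  simp [nrm, Complex.mul_conj']

lemma nrm_trace (n : ℕ) (U : Fin n → Matrix.unitaryGroup (Fin d × Fin D) ℂ) :
    (nrm (mps d D n U) : ℂ) = ((List.finRange n).map fun m =>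
      ∑ i, (siteMat d D (U m) i ⊗ₖ (siteMat d D (U m) i).map conj)).prod.trace := by
  rw [nrm_eq, ← sum_list_prod, Matrix.trace_sum]
  refine Finset.sum_congr rfl fun X _ => ?_
  unfold mps
  rw [conj_list, ← Matrix.trace_kronecker, kron_list]

lemma integ_quad (r r' c c' : Fin d × Fin D) : Integrable (fun U : Matrix.unitaryGroup (Fin d × Fin D) ℂ =>
    (U : Matrix (Fin d × Fin D) (Fin d × Fin D) ℂ) r c *
      conj ((U : Matrix (Fin d × Fin D) (Fin d × Fin D) ℂ) r' c')) μ := by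
  have hc : Measurable (fun z : ℂ => conj z) := Complex.continuous_conj.measurable
  refine Integrable.of_bound ((meas_entry _ _).mul (hc.comp (meas_entry _ _))).aestronglyMeasurable 1
    (Filter.Eventually.of_forall fun U => ?_)
  simp only [norm_mul, RCLike.norm_conj]
  exact mul_le_one₀ (entry_le U _ _) (norm_nonneg _) (entry_le U _ _)

lemma E_nrm (hd : 2 ≤ d) (hD : 2 ≤ D)
    (hμ : ∀ V : Matrix.unitaryGroup (Fin d × Fin D) ℂ, μ.map (fun U => V * U) = μ)
    (n : ℕ) (hn : n ≠ 0) :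
    Integrable (fun U => (nrm (mps d D n U) : ℂ)) (Measure.pi fun _ => μ) ∧
    ∫ U, (nrm (mps d D n U) : ℂ) ∂(Measure.pi fun _ => μ) = 1 := by
  have hcard : 1 < Fintype.card (Fin d × Fin D) := by
    simp; nlinarith
  have happ : ∀ (u : Matrix.unitaryGroup (Fin d × Fin D) ℂ) (i : Fin d) (a b : Fin D × Fin D),
      (siteMat d D u i ⊗ₖ (siteMat d D u i).map conj) a b =
      (u : Matrix (Fin d × Fin D) (Fin d × Fin D) ℂ) (i, a.1) (0, b.1) *
      conj ((u : Matrix (Fin d × Fin D) (Fin d × Fin D) ℂ) (i, a.2) (0, b.2)) := by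
    intro u i a b
    simp [Matrix.kroneckerMap_apply, siteMat]
  have hE := E_trace μ n (fun m u => ∑ i, (siteMat d D u i ⊗ₖ (siteMat d D u i).map conj)) (by
    intro m a b
    simp only [Matrix.sum_apply, happ]
    exact integrable_finsetSum _ fun x _ => integ_quad d D μ _ _ _ _)
  simp only [nrm_trace]
  refine ⟨hE.1, hE.2.trans ?_⟩
  have h2 : (d : ℂ) ≠ 0 := by exact_mod_cast (by omega : d ≠ 0)
  have h3 : (D : ℂ) ≠ 0 := by exact_mod_cast (by omega : D ≠ 0)
  set S : Matrix (Fin D × Fin D) (Fin 1) ℂ := Matrix.of fun x _ => if x.1 = x.2 then 1 else 0 with hS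
  have hsite : (Matrix.of fun a b => ∫ u : Matrix.unitaryGroup (Fin d × Fin D) ℂ,
      (∑ i, (siteMat d D u i ⊗ₖ (siteMat d D u i).map conj)) a b ∂μ) =
      S * ((D : ℂ)⁻¹ • (1 : Matrix (Fin 1) (Fin 1) ℂ)) * Sᵀ := by
    ext a b
    simp only [Matrix.of_apply, Matrix.sum_apply, happ]
    rw [integral_finsetSum _ fun x _ => integ_quad d D μ _ _ _ _]
    simp only [quad_wg μ hμ hcard _ _ _ _ ((d : ℂ) * D) (by simp)]
    simp [Matrix.mul_apply, hS]
    field_simp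
    split_ifs <;> simp [h3]
  have hS2 : Sᵀ * S * ((D : ℂ)⁻¹ • (1 : Matrix (Fin 1) (Fin 1) ℂ)) = 1 := by
    ext i j
    fin_cases i
    fin_cases j
    simp [Matrix.mul_apply, hS, Fintype.sum_prod_type, h3]
  simp only [hsite]
  rw [sandwich_trace S (fun _ : Fin n => ((D : ℂ)⁻¹ • (1 : Matrix (Fin 1) (Fin 1) ℂ))) _ (by simpa using hn)]
  simp only [hS2]
  simp
end Moments
section State
variable {n d : ℕ}

lemma PA_empty (ψ : (Fin n → Fin d) → ℂ) : PA ∅ ψ = (nrm ψ : ℂ) ^ 2 := by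
  rw [nrm_eq, pow_two, Finset.sum_mul_sum]
  refine Finset.sum_congr rfl fun X _ => Finset.sum_congr rfl fun Y _ => ?_
  have h : ∀ X Y : Fin n → Fin d, mixCfg ∅ X Y = X := fun X Y => by funext i; simp [mixCfg]
  rw [h, h]; ring

def cfgEquiv (A : Finset (Fin n)) :
    (((i : A) → Fin d) × ((i : (Aᶜ : Finset (Fin n))) → Fin d)) ≃ (Fin n → Fin d) where
  toFun p := mergeCfg A p.1 p.2
  invFun X := (fun i => X i, fun i => X i)
  left_inv p := by
    refine Prod.ext ?_ ?_
    · funext i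
      simp [mergeCfg]
    · funext i
      have := Finset.mem_compl.1 i.2
      simp [mergeCfg, this]
  right_inv X := by
    funext i
    simp [mergeCfg]

lemma mix_merge (A : Finset (Fin n)) (x y : (i : A) → Fin d)
    (z w : (i : (Aᶜ : Finset (Fin n))) → Fin d) :
    mixCfg A (mergeCfg A x z) (mergeCfg A y w) = mergeCfg A y z := by
  funext i
  by_cases h : i ∈ A <;> simp [mixCfg, mergeCfg, h]

lemma trace_rho (A : Finset (Fin n)) (ψ : (Fin n → Fin d) → ℂ) :
    (rhoA A ψ * rhoA A ψ).trace = PA A ψ := by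
  unfold PA
  rw [← (cfgEquiv A).sum_comp, Fintype.sum_prod_type]
  simp_rw [← (cfgEquiv (d := d) A).sum_comp, Fintype.sum_prod_type]
  simp only [cfgEquiv, Equiv.coe_fn_mk, mix_merge, Matrix.trace, Matrix.diag, Matrix.mul_apply,
    rhoA, Matrix.of_apply]
  refine Finset.sum_congr rfl fun x _ => ?_
  rw [Finset.sum_comm]
  refine Finset.sum_congr rfl fun y _ => ?_
  rw [Finset.sum_mul_sum]
  refine Finset.sum_congr rfl fun z _ => Finset.sum_congr rfl fun w _ => ?_
  ring

/-- diagonal of rho -/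
def rdiag (A : Finset (Fin n)) (ψ : (Fin n → Fin d) → ℂ) (x : (i : A) → Fin d) : ℝ :=
  ∑ z, ‖ψ (mergeCfg A x z)‖ ^ 2

lemma rdiag_sum (A : Finset (Fin n)) (ψ : (Fin n → Fin d) → ℂ) :
    ∑ x, rdiag A ψ x = nrm ψ := by
  unfold nrm rdiag
  rw [← (cfgEquiv A).sum_comp, Fintype.sum_prod_type]
  rfl

lemma rho_diag (A : Finset (Fin n)) (ψ : (Fin n → Fin d) → ℂ) (x : (i : A) → Fin d) :
    rhoA A ψ x x = rdiag A ψ x := by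
  simp [rhoA, rdiag, Complex.mul_conj']

/-- purity -/
def pur (A : Finset (Fin n)) (ψ : (Fin n → Fin d) → ℂ) : ℝ := ∑ x, ∑ y, ‖rhoA A ψ x y‖ ^ 2

lemma pur_eq (A : Finset (Fin n)) (ψ : (Fin n → Fin d) → ℂ) :
    (rhoA A ψ * rhoA A ψ).trace = (pur A ψ : ℂ) := by
  simp only [Matrix.trace, Matrix.diag, Matrix.mul_apply, pur]
  push_cast
  refine Finset.sum_congr rfl fun x _ => Finset.sum_congr rfl fun y _ => ?_
  have : rhoA A ψ y x = conj (rhoA A ψ x y) := by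
    simp only [rhoA, Matrix.of_apply, map_sum, map_mul, Complex.conj_conj]
    exact Finset.sum_congr rfl fun z _ => mul_comm _ _
  rw [this, Complex.mul_conj']

lemma pur_nonneg (A : Finset (Fin n)) (ψ : (Fin n → Fin d) → ℂ) : 0 ≤ pur A ψ := by
  unfold pur; positivity

lemma nrm_nonneg (ψ : (Fin n → Fin d) → ℂ) : 0 ≤ nrm ψ := by
  unfold nrm; positivity

lemma pur_le (A : Finset (Fin n)) (ψ : (Fin n → Fin d) → ℂ) : pur A ψ ≤ nrm ψ ^ 2 := by
  rw [← rdiag_sum A, pow_two, Finset.sum_mul_sum]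
  refine Finset.sum_le_sum fun x _ => Finset.sum_le_sum fun y _ => ?_
  have h1 : ‖rhoA A ψ x y‖ ≤ ∑ z, ‖ψ (mergeCfg A x z)‖ * ‖ψ (mergeCfg A y z)‖ := by
    simp only [rhoA, Matrix.of_apply]
    refine (norm_sum_le _ _).trans (le_of_eq ?_)
    refine Finset.sum_congr rfl fun z _ => ?_
    rw [norm_mul, RCLike.norm_conj]
  calc ‖rhoA A ψ x y‖ ^ 2 ≤ (∑ z, ‖ψ (mergeCfg A x z)‖ * ‖ψ (mergeCfg A y z)‖) ^ 2 := by
        gcongr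
    _ ≤ _ := Finset.sum_mul_sq_le_sq_mul_sq _ _ _

lemma pur_pos (A : Finset (Fin n)) (ψ : (Fin n → Fin d) → ℂ) (h : 0 < nrm ψ) : 0 < pur A ψ := by
  rw [← rdiag_sum A] at h
  obtain ⟨x, _, hx⟩ := Finset.exists_lt_of_sum_lt (s := Finset.univ) (f := fun _ => (0 : ℝ))
    (g := rdiag A ψ) (by simpa using h)
  have h1 : 0 < ‖rhoA A ψ x x‖ ^ 2 := by
    rw [rho_diag]
    have : (rdiag A ψ x : ℂ) ≠ 0 := by exact_mod_cast hx.ne'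
    positivity
  unfold pur
  calc (0 : ℝ) < ‖rhoA A ψ x x‖ ^ 2 := h1
    _ ≤ ∑ y, ‖rhoA A ψ x y‖ ^ 2 :=
      Finset.single_le_sum (f := fun y => ‖rhoA A ψ x y‖ ^ 2) (fun y _ => by positivity) (Finset.mem_univ x)
    _ ≤ _ := Finset.single_le_sum (f := fun x => ∑ y, ‖rhoA A ψ x y‖ ^ 2)
      (fun y _ => Finset.sum_nonneg fun _ _ => sq_nonneg _) (Finset.mem_univ x)

lemma nrm_pos_ne (ψ : (Fin n → Fin d) → ℂ) (h : 0 < nrm ψ) : ψ ≠ 0 := by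
  rintro rfl
  simp [nrm] at h

lemma target_eq (A : Finset (Fin n)) (ψ : (Fin n → Fin d) → ℂ) :
    (Matrix.trace ((((∑ x, ‖ψ x‖ ^ 2 : ℝ) : ℂ))⁻¹ • rhoA A ψ *
      ((((∑ x, ‖ψ x‖ ^ 2 : ℝ) : ℂ))⁻¹ • rhoA A ψ))).re = pur A ψ / nrm ψ ^ 2 := by
  rw [show (∑ x, ‖ψ x‖ ^ 2 : ℝ) = nrm ψ from rfl]
  rw [Matrix.smul_mul, Matrix.mul_smul, Matrix.trace_smul, Matrix.trace_smul, pur_eq]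
  simp only [smul_eq_mul]
  rw [← Complex.ofReal_inv, ← Complex.ofReal_mul, ← Complex.ofReal_mul, Complex.ofReal_re]
  field_simp

lemma nrm_bdd (d D n : ℕ) [NeZero d] : ∃ C : ℝ, 1 ≤ C ∧ ∀ U, nrm (mps d D n U) ≤ C := by
  choose κ hκ i j h using fun a : Fin D => path_exists n a a
  set B : ℝ := ∑ a, (Fintype.card (κ a) : ℝ) with hB
  have hb : ∀ U x, ‖mps d D n U x‖ ≤ B := by
    intro U x
    unfold mps Matrix.trace
    refine (norm_sum_le _ _).trans (Finset.sum_le_sum fun a _ => ?_)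
    rw [Matrix.diag, h a]
    refine (norm_sum_le _ _).trans ?_
    have : ∀ k ∈ (Finset.univ : Finset (κ a)),
        ‖∏ m, siteMat d D (U m) (x m) (i a k m) (j a k m)‖ ≤ 1 := by
      intro k _
      rw [norm_prod]
      exact Finset.prod_le_one (fun _ _ => norm_nonneg _) fun m _ => entry_le (U m) _ _
    refine (Finset.sum_le_sum this).trans ?_
    simp
  refine ⟨1 + ∑ x : Fin n → Fin d, B ^ 2, ?_, fun U => ?_⟩
  · have : 0 ≤ ∑ x : Fin n → Fin d, B ^ 2 := by positivity
    linarith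
  · have : nrm (mps d D n U) ≤ ∑ x : Fin n → Fin d, B ^ 2 := by
      refine Finset.sum_le_sum fun x _ => ?_
      have := hb U x
      gcongr
    linarith
end State
section TwoByTwo

lemma TB_pow (a b : ℝ) (ha : 0 ≤ a) (hb : 0 ≤ b) (hab : a + b < 1) (j : ℕ) :
    ∃ s : ℝ, 0 ≤ s ∧ s + a ^ j ≤ 1 ∧ TB a b ^ j = !![1, 0; s, a ^ j] := by
  induction j with
  | zero => exact ⟨0, le_rfl, by simp, by simp [Matrix.one_fin_two]⟩
  | succ j ih =>
    obtain ⟨s, hs, hs1, h⟩ := ih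
    have haj : 0 ≤ a ^ j := by positivity
    refine ⟨s + a ^ j * b, by positivity, ?_, ?_⟩
    · rw [pow_succ]; nlinarith
    · rw [pow_succ, h, TB, pow_succ]
      simp

lemma M_rows (a b : ℝ) (ha : 0 ≤ a) (hb : 0 ≤ b) (hab : a + b < 1) (k : ℕ) (hk : 2 ≤ k) :
    ∃ r : ℝ, 0 < r ∧ r < 1 ∧ ∀ i, (∀ j, 0 ≤ (TB a b ^ (k - 1) * TA a b) i j) ∧
      (TB a b ^ (k - 1) * TA a b) i 0 + (TB a b ^ (k - 1) * TA a b) i 1 ≤ r := by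
  obtain ⟨s, hs, hs1, h⟩ := TB_pow a b ha hb hab (k - 1)
  have hak : a ^ (k - 1) < 1 := pow_lt_one₀ ha (by linarith) (by omega)
  have hak0 : 0 ≤ a ^ (k - 1) := by positivity
  have hr : s * (a + b) + a ^ (k - 1) < 1 := by nlinarith
  rw [h, TA]
  refine ⟨max (1/2) (max (a + b) (s * (a + b) + a ^ (k - 1))), by simp, ?_, ?_⟩
  · simp only [max_lt_iff]
    exact ⟨by norm_num, hab, hr⟩
  · intro i
    fin_cases i
    · refine ⟨fun j => ?_, ?_⟩
      · fin_cases j <;> simp [ha, hb]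
      · simp
    · refine ⟨fun j => ?_, ?_⟩
      · fin_cases j <;> simp <;> positivity
      · simp [mul_add, add_assoc]

lemma pow_rows (M : Matrix (Fin 2) (Fin 2) ℝ) (r : ℝ)
    (hM : ∀ i, (∀ j, 0 ≤ M i j) ∧ M i 0 + M i 1 ≤ r) (m : ℕ) :
    ∀ i, (∀ j, 0 ≤ (M ^ m) i j) ∧ (M ^ m) i 0 + (M ^ m) i 1 ≤ r ^ m := by
  have hr : 0 ≤ r := by
    have h1 := (hM 0).2
    have h2 := (hM 0).1 0
    have h3 := (hM 0).1 1
    linarith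
  induction m with
  | zero =>
    intro i
    refine ⟨fun j => ?_, ?_⟩
    · rw [pow_zero, Matrix.one_apply]; split_ifs <;> norm_num
    · fin_cases i <;> simp
  | succ m ih =>
    intro i
    have h0 := (ih i).1 0
    have h1 := (ih i).1 1
    have h2 := (ih i).2
    refine ⟨fun j => ?_, ?_⟩
    · rw [pow_succ, Matrix.mul_apply, Fin.sum_univ_two]
      have := (hM 0).1 j
      have := (hM 1).1 j
      positivity
    · rw [pow_succ, Matrix.mul_apply, Matrix.mul_apply, Fin.sum_univ_two, Fin.sum_univ_two, pow_succ]
      have := (hM 0).2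
      have := (hM 1).2
      nlinarith [mul_le_mul_of_nonneg_left (hM 0).2 h0, mul_le_mul_of_nonneg_left (hM 1).2 h1,
        mul_le_mul_of_nonneg_right h2 hr]

lemma trace_lt (Q : Matrix (Fin 2) (Fin 2) ℝ) (hQ : ∀ i, (∀ j, 0 ≤ Q i j) ∧ Q i 0 + Q i 1 < 1) :
    Q.trace < 1 + Q.det := by
  rw [Matrix.trace_fin_two, Matrix.det_fin_two]
  have a1 := (hQ 0).1 0
  have a2 := (hQ 0).1 1
  have a3 := (hQ 1).1 0
  have a4 := (hQ 1).1 1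
  have a5 := (hQ 0).2
  have a6 := (hQ 1).2
  have : Q 0 1 * Q 1 0 < (1 - Q 0 0) * (1 - Q 1 1) :=
    mul_lt_mul'' (by linarith) (by linarith) a2 a3
  nlinarith

lemma eta_facts (d D : ℕ) (hd : 2 ≤ d) (hD : 2 ≤ D) :
    0 < etaF d D ∧ 0 < etaF D d ∧ etaF d D + etaF D d < 1 := by
  have h1 : (2 : ℝ) ≤ d := by exact_mod_cast hd
  have h2 : (2 : ℝ) ≤ D := by exact_mod_cast hD
  have hq : 4 ≤ (d : ℝ) * D := by nlinarith
  have h3 : (0 : ℝ) < (d : ℝ) ^ 2 * (D : ℝ) ^ 2 - 1 := by nlinarith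
  have h4 : (D : ℝ) ^ 2 * (d : ℝ) ^ 2 - 1 = (d : ℝ) ^ 2 * (D : ℝ) ^ 2 - 1 := by ring
  unfold etaF
  refine ⟨div_pos (by nlinarith) h3, ?_, ?_⟩
  · rw [h4]
    exact div_pos (by nlinarith) h3
  · rw [h4, ← add_div, div_lt_one h3]
    have h5 : (d : ℝ) + D < d * D + 1 := by nlinarith
    nlinarith [mul_lt_mul_of_pos_left h5 (show (0:ℝ) < d * D - 1 by linarith)]

lemma range_prod {R : Type*} [Monoid R] (x y : R) (k : ℕ) (hk : 2 ≤ k) (m : ℕ) :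
    ((List.range (k * m)).map fun i => if k ∣ i + 1 then x else y).prod = (y ^ (k - 1) * x) ^ m := by
  induction m with
  | zero => simp
  | succ m ih =>
    rw [Nat.mul_succ, List.range_add, List.map_append, List.prod_append, ih, pow_succ, List.map_map]
    congr 1
    obtain ⟨l, rfl⟩ : ∃ l, k = l + 1 := ⟨k - 1, by omega⟩
    rw [List.range_succ, List.map_append, List.prod_append, Nat.add_sub_cancel]
    congr 1
    · have : ∀ i ∈ List.range l, ((fun i => if l + 1 ∣ i + 1 then x else y) ∘ fun x => (l + 1) * m + x) i = y := by
        intro i hi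
        have hi := List.mem_range.1 hi
        simp only [Function.comp]
        rw [if_neg]
        rw [add_assoc, Nat.dvd_add_right (Dvd.intro m rfl)]
        intro h
        have := Nat.le_of_dvd (by omega) h
        omega
      rw [List.map_congr_left this]
      simp
    · simp only [List.map_cons, List.map_nil, List.prod_singleton, Function.comp]
      rw [if_pos]
      exact ⟨m + 1, by ring⟩

lemma Tprod_A (d D k m : ℕ) (hk : 2 ≤ k) :
    Tprod d D (k * m) (Finset.univ.filter fun i : Fin (k * m) => k ∣ ((i : ℕ) + 1)) =
      (TB (etaF d D) (etaF D d) ^ (k - 1) * TA (etaF d D) (etaF D d)) ^ m := by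
  rw [← range_prod _ _ k hk, ← List.map_coe_finRange_eq_range, List.map_map]
  unfold Tprod
  simp [Function.comp_def]

lemma Tprod_empty (d D n : ℕ) (hd : 2 ≤ d) (hD : 2 ≤ D) :
    (Tprod d D n ∅).trace = 1 + etaF d D ^ n := by
  obtain ⟨h1, h2, h3⟩ := eta_facts d D hd hD
  obtain ⟨s, -, -, h⟩ := TB_pow _ _ h1.le h2.le h3 n
  have : Tprod d D n ∅ = TB (etaF d D) (etaF D d) ^ n := by simp [Tprod]
  rw [this, h]
  simp [Matrix.trace_fin_two]

lemma Tprod_facts (d D k : ℕ) (hd : 2 ≤ d) (hD : 2 ≤ D) (hk : 2 ≤ k) :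
    ∃ r : ℝ, 0 < r ∧ r < 1 ∧ ∀ m : ℕ, m ≠ 0 →
      (Tprod d D (k * m) (Finset.univ.filter fun i : Fin (k * m) => k ∣ ((i : ℕ) + 1))).trace ≤ 2 * r ^ m ∧
      (Tprod d D (k * m) (Finset.univ.filter fun i : Fin (k * m) => k ∣ ((i : ℕ) + 1))).trace
        < 1 + etaF d D ^ (k * m) := by
  obtain ⟨h1, h2, h3⟩ := eta_facts d D hd hD
  obtain ⟨r, hr0, hr1, hM⟩ := M_rows _ _ h1.le h2.le h3 k hk
  refine ⟨r, hr0, hr1, fun m hm => ?_⟩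
  rw [Tprod_A d D k m hk]
  have hrows := pow_rows _ r hM m
  constructor
  · rw [Matrix.trace_fin_two]
    have := (hrows 0).2
    have := (hrows 1).2
    have := (hrows 0).1 1
    have := (hrows 1).1 0
    linarith
  · have hlt := trace_lt _ (fun i => ⟨(hrows i).1, (hrows i).2.trans_lt (pow_lt_one₀ hr0.le hr1 hm)⟩)
    convert hlt using 2
    rw [Matrix.det_pow, Matrix.det_mul, Matrix.det_pow]
    simp only [TA, TB, Matrix.det_fin_two_of]
    rw [pow_mul]
    congr 1
    obtain ⟨l, rfl⟩ : ∃ l, k = l + 1 := ⟨k - 1, by omega⟩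
    simp [pow_succ]
end TwoByTwo
section Final

lemma real_of {Ω : Type*} [MeasurableSpace Ω] (P : Measure Ω) (f : Ω → ℝ) (c : ℝ)
    (h : Integrable (fun x => (f x : ℂ)) P) (h2 : ∫ x, (f x : ℂ) ∂P = c) :
    Integrable f P ∧ ∫ x, f x ∂P = c := by
  refine ⟨by simpa using h.re, ?_⟩
  rw [integral_complex_ofReal] at h2
  exact_mod_cast h2

lemma prob_large {Ω : Type*} [MeasurableSpace Ω] (P : Measure Ω) [IsProbabilityMeasure P]
    (N g : Ω → ℝ) (v s : ℝ) (hs : 0 < s) (hN : Integrable N P) (hN2 : Integrable (fun x => N x ^ 2) P)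
    (hg : Integrable g P) (hg0 : ∀ x, 0 ≤ g x) (eN : ∫ x, N x ∂P = 1)
    (eN2 : ∫ x, N x ^ 2 ∂P = 1 + v) (eg : ∫ x, g x ∂P ≤ 2 * s ^ 2) (G : Set Ω)
    (hG : ∀ x, 1 / 2 < N x → g x < s → x ∈ G) :
    1 - (4 * v + 2 * s) ≤ P.real G := by
  have hi1 : Integrable (fun x => N x ^ 2 - 2 * N x) P := hN2.sub (hN.const_mul 2)
  have e0 : ∫ x, ((N x ^ 2 - 2 * N x) + 1) ∂P = v := by
    rw [integral_add hi1 (integrable_const 1), integral_sub hN2 (hN.const_mul 2),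
      integral_const_mul, eN, eN2]
    simp only [integral_const, probReal_univ, smul_eq_mul]
    ring
  have m1 := mul_meas_ge_le_integral_of_nonneg (μ := P) (f := fun x => (N x ^ 2 - 2 * N x) + 1)
    (Filter.Eventually.of_forall fun x => by
      simp only [Pi.zero_apply]; nlinarith [sq_nonneg (N x - 1)])
    (hi1.add (integrable_const 1)) (1 / 4)
  rw [e0] at m1
  have m2 := mul_meas_ge_le_integral_of_nonneg (μ := P) (f := g)
    (Filter.Eventually.of_forall hg0) hg s
  have m3 : P.real {x | s ≤ g x} ≤ 2 * s := by
    have : s * P.real {x | s ≤ g x} ≤ s * (2 * s) := by nlinarith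
    exact le_of_mul_le_mul_left this hs
  have hcov : (Set.univ : Set Ω) ⊆
      G ∪ ({x | 1 / 4 ≤ (N x ^ 2 - 2 * N x) + 1} ∪ {x | s ≤ g x}) := by
    intro x _
    by_cases h1 : 1 / 2 < N x
    · by_cases h2 : g x < s
      · exact Or.inl (hG x h1 h2)
      · exact Or.inr (Or.inr (not_lt.1 h2))
    · refine Or.inr (Or.inl ?_)
      simp only [Set.mem_setOf_eq]
      nlinarith
  have h1 := measureReal_mono (μ := P) hcov
  rw [probReal_univ] at h1
  have h2 := measureReal_union_le (μ := P) G ({x | 1 / 4 ≤ (N x ^ 2 - 2 * N x) + 1} ∪ {x | s ≤ g x})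
  have h3 := measureReal_union_le (μ := P) {x | 1 / 4 ≤ (N x ^ 2 - 2 * N x) + 1} {x | s ≤ g x}
  linarith

lemma prob_small {Ω : Type*} [MeasurableSpace Ω] (P : Measure Ω) [IsProbabilityMeasure P]
    (h : Ω → ℝ) (δ C : ℝ) (hδ : 0 < δ) (hi : Integrable h P) (hC : ∀ x, h x ≤ C)
    (e : ∫ x, h x ∂P = δ) (G : Set Ω) (hG : ∀ x, δ / 2 < h x → x ∈ G) :
    δ / (2 * C) ≤ P.real G := by
  have hδC : δ ≤ C := by
    rw [← e]
    refine (integral_mono hi (integrable_const C) hC).trans ?_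
    simp
  have m1 := mul_meas_ge_le_integral_of_nonneg (μ := P) (f := fun x => C - h x)
    (Filter.Eventually.of_forall fun x => by simp [hC x])
    ((integrable_const C).sub hi) (C - δ / 2)
  rw [integral_sub (integrable_const C) hi, e] at m1
  simp only [integral_const, probReal_univ, smul_eq_mul, one_mul] at m1
  have hcov : (Set.univ : Set Ω) ⊆ G ∪ {x | C - δ / 2 ≤ C - h x} := by
    intro x _
    by_cases h1 : δ / 2 < h x
    · exact Or.inl (hG x h1)
    · refine Or.inr ?_
      simp only [Set.mem_setOf_eq]
      linarith
  have h1 := measureReal_mono (μ := P) hcov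
  rw [probReal_univ] at h1
  have h2 := measureReal_union_le (μ := P) G {x | C - δ / 2 ≤ C - h x}
  rw [div_le_iff₀ (by linarith)]
  have h0 : 0 ≤ P.real G := measureReal_nonneg
  nlinarith

/-- The event bound at `n = k * m` with constants `c`. -/
def Good (d D k : ℕ) [NeZero d] (m : ℕ) (c : ℝ) : Prop :=
  ∀ (μ : Measure (Matrix.unitaryGroup (Fin d × Fin D) ℂ)) [IsProbabilityMeasure μ],
    (∀ V : Matrix.unitaryGroup (Fin d × Fin D) ℂ, μ.map (fun U => V * U) = μ) →
    1 - Real.exp (-(c * m)) ≤ (Measure.pi fun _ : Fin (k * m) => μ).real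
      {U | mps d D (k * m) U ≠ 0 ∧ c * m ≤ -Real.log
        (pur (Finset.univ.filter fun i : Fin (k * m) => k ∣ ((i : ℕ) + 1)) (mps d D (k * m) U) /
          nrm (mps d D (k * m) U) ^ 2)}

lemma Good_mono (d D k : ℕ) [NeZero d] (m : ℕ) (c c' : ℝ) (h : c' ≤ c) (hg : Good d D k m c) :
    Good d D k m c' := by
  intro μ _ hμ
  have hm : c' * m ≤ c * m := by gcongr
  refine le_trans ?_ ((hg μ hμ).trans (measureReal_mono ?_))
  · have : Real.exp (-(c * m)) ≤ Real.exp (-(c' * m)) := Real.exp_le_exp.2 (by linarith)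
    linarith
  · rintro U ⟨h1, h2⟩
    exact ⟨h1, hm.trans h2⟩

lemma facts (d D k : ℕ) [NeZero d] (hd : 2 ≤ d) (hD : 2 ≤ D) (hk : 2 ≤ k) (m : ℕ) (hm : m ≠ 0)
    (μ : Measure (Matrix.unitaryGroup (Fin d × Fin D) ℂ)) [IsProbabilityMeasure μ]
    (hμ : ∀ V : Matrix.unitaryGroup (Fin d × Fin D) ℂ, μ.map (fun U => V * U) = μ)
    (A : Finset (Fin (k * m))) :
    (Integrable (fun U => nrm (mps d D (k * m) U)) (Measure.pi fun _ => μ) ∧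
      ∫ U, nrm (mps d D (k * m) U) ∂(Measure.pi fun _ => μ) = 1) ∧
    (Integrable (fun U => nrm (mps d D (k * m) U) ^ 2) (Measure.pi fun _ => μ) ∧
      ∫ U, nrm (mps d D (k * m) U) ^ 2 ∂(Measure.pi fun _ => μ) = 1 + etaF d D ^ (k * m)) ∧
    (Integrable (fun U => pur A (mps d D (k * m) U)) (Measure.pi fun _ => μ) ∧
      ∫ U, pur A (mps d D (k * m) U) ∂(Measure.pi fun _ => μ) = (Tprod d D (k * m) A).trace) := by
  have hn : k * m ≠ 0 := Nat.mul_ne_zero (by omega) hm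
  refine ⟨?_, ?_, ?_⟩
  · obtain ⟨h1, h2⟩ := E_nrm d D μ hd hD hμ (k * m) hn
    exact real_of _ _ _ h1 (by simpa using h2)
  · obtain ⟨h1, h2⟩ := E_PA d D μ hd hD hμ (k * m) hn ∅
    simp only [PA_empty] at h1 h2
    rw [Tprod_empty d D _ hd hD] at h2
    exact real_of _ _ _ (by simpa using h1) (by simpa using h2)
  · obtain ⟨h1, h2⟩ := E_PA d D μ hd hD hμ (k * m) hn A
    simp only [← trace_rho, pur_eq] at h1 h2
    exact real_of _ _ _ h1 h2

lemma Good_small (d D k : ℕ) [NeZero d] (hd : 2 ≤ d) (hD : 2 ≤ D) (hk : 2 ≤ k) (m : ℕ) :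
    ∃ c : ℝ, 0 < c ∧ Good d D k m c := by
  by_cases hm : m = 0
  · subst hm
    refine ⟨1, one_pos, fun μ _ hμ => ?_⟩
    simp only [Nat.cast_zero, mul_zero, neg_zero, Real.exp_zero, sub_self]
    exact measureReal_nonneg
  obtain ⟨r, hr0, hr1, hT⟩ := Tprod_facts d D k hd hD hk
  obtain ⟨-, hT2⟩ := hT m hm
  obtain ⟨C, hC1, hC⟩ := nrm_bdd d D (k * m)
  set A := (Finset.univ.filter fun i : Fin (k * m) => k ∣ ((i : ℕ) + 1)) with hA
  set δ : ℝ := 1 + etaF d D ^ (k * m) - (Tprod d D (k * m) A).trace with hδ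
  have hδ0 : 0 < δ := by rw [hδ]; linarith
  have hm' : (0 : ℝ) < m := by exact_mod_cast Nat.pos_of_ne_zero hm
  have hp : 0 < δ / (2 * C ^ 2) := by positivity
  refine ⟨δ / (2 * C ^ 2) / m, by positivity, fun μ _ hμ => ?_⟩
  rw [div_mul_cancel₀ _ hm'.ne']
  obtain ⟨-, ⟨i2, e2⟩, ⟨i3, e3⟩⟩ := facts d D k hd hD hk m hm μ hμ A
  have hexp := Real.add_one_le_exp (-(δ / (2 * C ^ 2)))
  refine le_trans (b := δ / (2 * C ^ 2)) (by linarith) ?_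
  have hC2 : ∀ U, nrm (mps d D (k * m) U) ^ 2 ≤ C ^ 2 := fun U =>
    pow_le_pow_left₀ (nrm_nonneg _) (hC U) 2
  refine prob_small _ (fun U => nrm (mps d D (k * m) U) ^ 2 - pur A (mps d D (k * m) U)) δ (C ^ 2) hδ0
    (i2.sub i3) (fun U => ?_) ?_ _ (fun U hU => ?_)
  · have := pur_nonneg A (mps d D (k * m) U)
    have := hC2 U
    linarith
  · rw [integral_sub i2 i3, e2, e3]
  · have hp0 := pur_nonneg A (mps d D (k * m) U)
    have hN0 := nrm_nonneg (mps d D (k * m) U)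
    have hNpos : 0 < nrm (mps d D (k * m) U) := by
      rcases hN0.eq_or_lt with h | h
      · rw [← h] at hU
        norm_num at hU
        linarith
      · exact h
    have hppos := pur_pos A _ hNpos
    refine ⟨nrm_pos_ne _ hNpos, ?_⟩
    have hCC := hC2 U
    have h1 : pur A (mps d D (k * m) U) / nrm (mps d D (k * m) U) ^ 2 ≤ 1 - δ / (2 * C ^ 2) := by
      rw [div_le_iff₀ (by positivity)]
      have : δ / (2 * C ^ 2) * nrm (mps d D (k * m) U) ^ 2 ≤ δ / 2 := by
        calc _ ≤ δ / (2 * C ^ 2) * C ^ 2 := by gcongr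
          _ = δ / 2 := by field_simp
      linarith
    have h2 := Real.log_le_sub_one_of_pos (show 0 < pur A (mps d D (k * m) U) /
      nrm (mps d D (k * m) U) ^ 2 by positivity)
    linarith

lemma Good_large (d D k : ℕ) [NeZero d] (hd : 2 ≤ d) (hD : 2 ≤ D) (hk : 2 ≤ k) :
    ∃ c : ℝ, 0 < c ∧ ∃ m₀ : ℕ, ∀ m, m₀ ≤ m → Good d D k m c := by
  obtain ⟨r, hr0, hr1, hT⟩ := Tprod_facts d D k hd hD hk
  obtain ⟨ha0, hb0, hab⟩ := eta_facts d D hd hD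
  set a := etaF d D with ha
  obtain ⟨w, hw0, hw1, haw, hrw⟩ : ∃ w : ℝ, 0 < w ∧ w < 1 ∧ a ≤ w ∧ r ≤ w :=
    ⟨max a r, lt_max_of_lt_left ha0, max_lt (by linarith) hr1, le_max_left _ _, le_max_right _ _⟩
  obtain ⟨u, hu0, hu1, huw⟩ : ∃ u : ℝ, 0 < u ∧ u < 1 ∧ w = u ^ 4 := by
    refine ⟨√(√w), by positivity, ?_, ?_⟩
    · rw [Real.sqrt_lt' one_pos, Real.sqrt_lt' (by norm_num)]; simpa using hw1
    · rw [show (4 : ℕ) = 2 * 2 from rfl, pow_mul, Real.sq_sqrt (by positivity), Real.sq_sqrt hw0.le]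
  have hlog : Real.log u < 0 := Real.log_neg hu0 hu1
  refine ⟨-Real.log u, by linarith, ?_⟩
  have hev := (tendsto_pow_atTop_nhds_zero_of_lt_one hu0.le hu1).eventually
    (gt_mem_nhds (show (0 : ℝ) < 1 / 6 by norm_num))
  obtain ⟨m₁, hm₁⟩ := Filter.eventually_atTop.1 hev
  refine ⟨m₁ + 1, fun m hmm μ _ hμ => ?_⟩
  have hm : m ≠ 0 := by omega
  have hum : u ^ m < 1 / 6 := hm₁ m (by omega)
  have hum0 : 0 < u ^ m := by positivity
  have hexp : Real.exp (-(-Real.log u * m)) = u ^ m := by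
    rw [show -(-Real.log u * m) = m * Real.log u by ring, Real.exp_nat_mul, Real.exp_log hu0]
  rw [hexp]
  set A := (Finset.univ.filter fun i : Fin (k * m) => k ∣ ((i : ℕ) + 1)) with hA
  obtain ⟨⟨i1, e1⟩, ⟨i2, e2⟩, ⟨i3, e3⟩⟩ := facts d D k hd hD hk m hm μ hμ A
  have hv : a ^ (k * m) ≤ (u ^ m) ^ 2 := by
    calc a ^ (k * m) ≤ a ^ m := pow_le_pow_of_le_one ha0.le (by linarith) (by nlinarith)
      _ ≤ (u ^ 4) ^ m := by rw [← huw]; gcongr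
      _ = (u ^ m) ^ 4 := by rw [← pow_mul, ← pow_mul, mul_comm]
      _ ≤ (u ^ m) ^ 2 := pow_le_pow_of_le_one hum0.le (by linarith) (by norm_num)
  have ht : (Tprod d D (k * m) A).trace ≤ 2 * ((u ^ m) ^ 2) ^ 2 := by
    refine (hT m hm).1.trans ?_
    have : r ^ m ≤ ((u ^ m) ^ 2) ^ 2 := by
      calc r ^ m ≤ (u ^ 4) ^ m := by rw [← huw]; gcongr
        _ = ((u ^ m) ^ 2) ^ 2 := by rw [← pow_mul, ← pow_mul, ← pow_mul]; congr 1; ring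
    linarith
  refine le_trans ?_ (prob_large _ (fun U => nrm (mps d D (k * m) U))
    (fun U => pur A (mps d D (k * m) U)) (a ^ (k * m)) ((u ^ m) ^ 2) (by positivity) i1 i2 i3
    (fun U => pur_nonneg _ _) e1 e2 (e3.trans_le ht) _ (fun U hU1 hU2 => ?_))
  · nlinarith
  · have hNpos : 0 < nrm (mps d D (k * m) U) := by linarith
    have hppos := pur_pos A _ hNpos
    refine ⟨nrm_pos_ne _ hNpos, ?_⟩
    have h1 : pur A (mps d D (k * m) U) / nrm (mps d D (k * m) U) ^ 2 ≤ u ^ m := by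
      rw [div_le_iff₀ (by positivity)]
      have : (1 : ℝ) / 4 ≤ nrm (mps d D (k * m) U) ^ 2 := by nlinarith
      nlinarith
    have h2 := Real.log_le_log (by positivity) h1
    rw [Real.log_pow] at h2
    linarith

lemma unif (Q : ℕ → ℝ → Prop) (hmono : ∀ m c c', c' ≤ c → Q m c → Q m c')
    (h1 : ∀ m, ∃ c : ℝ, 0 < c ∧ Q m c) (m₀ : ℕ) : ∃ c : ℝ, 0 < c ∧ ∀ m < m₀, Q m c := by
  induction m₀ with
  | zero => exact ⟨1, one_pos, fun m hm => absurd hm (by omega)⟩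
  | succ m₀ ih =>
    obtain ⟨c, hc, h⟩ := ih
    obtain ⟨c', hc', h'⟩ := h1 m₀
    refine ⟨min c c', lt_min hc hc', fun m hm => ?_⟩
    rcases Nat.lt_succ_iff_lt_or_eq.1 hm with h2 | rfl
    · exact hmono _ _ _ (min_le_left _ _) (h m h2)
    · exact hmono _ _ _ (min_le_right _ _) h'

end Final

/-- extensivity of the Rényi 2-entropy for disconnected subsystems.
Fix `d, D, k ≥ 2` with `β := η(d,D)^{k−1} + η(D,d) + η(d,D) < 1`.  Then there are
constants `c₁, c₂ > 0` (depending only on `d, D, k`) such that for every `n` divisible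
by `k`, with `A` the set of every `k`-th site (0-based: sites `i` with `k ∣ i+1`),
the RMPS satisfies `ψ ≠ 0` and `S₂(ρ'_A) = −log Tr[ρ'_A²] ≥ c₁ n/k` with probability at
least `1 − e^{−c₂ n/k}`.  The site unitaries are drawn i.i.d. from the Haar probability
measure on `U(dD)` (the unique left-invariant Borel probability measure). -/
theorem renyi2_extensive
    (d D k : ℕ) [NeZero d] (hd : 2 ≤ d) (hD : 2 ≤ D) (hk : 2 ≤ k)
    (hβ : etaF d D ^ (k - 1) + etaF D d + etaF d D < 1) :
    ∃ c₁ c₂ : ℝ, 0 < c₁ ∧ 0 < c₂ ∧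
      ∀ n : ℕ, k ∣ n →
      ∀ (μ : Measure (Matrix.unitaryGroup (Fin d × Fin D) ℂ)) [IsProbabilityMeasure μ],
        (∀ V : Matrix.unitaryGroup (Fin d × Fin D) ℂ, μ.map (fun U => V * U) = μ) →
        ENNReal.ofReal (1 - Real.exp (-(c₂ * ((n : ℝ) / k))))
          ≤ (Measure.pi fun _ : Fin n => μ)
            {U | mps d D n U ≠ 0 ∧
              c₁ * ((n : ℝ) / k) ≤
                -Real.log
                  ((Matrix.trace
                    ((((∑ x, ‖mps d D n U x‖ ^ 2 : ℝ) : ℂ))⁻¹ •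
                        rhoA (Finset.univ.filter fun i : Fin n => k ∣ ((i : ℕ) + 1))
                          (mps d D n U) *
                      ((((∑ x, ‖mps d D n U x‖ ^ 2 : ℝ) : ℂ))⁻¹ •
                        rhoA (Finset.univ.filter fun i : Fin n => k ∣ ((i : ℕ) + 1))
                          (mps d D n U)))).re)} := by
  obtain ⟨c, hc, m₀, hl⟩ := Good_large d D k hd hD hk
  obtain ⟨c', hc', hs⟩ := unif (Good d D k) (Good_mono d D k) (Good_small d D k hd hD hk) m₀
  refine ⟨min c c', min c c', lt_min hc hc', lt_min hc hc', ?_⟩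
  rintro n ⟨m, rfl⟩ μ _ hμ
  have hgood : Good d D k m (min c c') := by
    rcases lt_or_ge m m₀ with h | h
    · exact Good_mono _ _ _ _ _ _ (min_le_right _ _) (hs m h)
    · exact Good_mono _ _ _ _ _ _ (min_le_left _ _) (hl m h)
  have hk0 : (k : ℝ) ≠ 0 := by exact_mod_cast (by omega : k ≠ 0)
  have hnk : ((k * m : ℕ) : ℝ) / k = m := by
    push_cast
    field_simp
  simp only [hnk, target_eq]
  exact ENNReal.ofReal_le_of_le_toReal (hgood μ hμ)
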